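/- Let G=(V,w) be a weighted graph, o a vertex and z a set of vertices with dist(o,z) ≥ n+1 for an integer n ≥ 0, and let g > 1 be a solution of (g−1)² g^{n−2} = 2 w_z/w_o. Then the expected hitting time satisfies E[T_{oz}] ≥ n(g+1)/(g−1) + 1. -/

import Mathlib

open MeasureTheory Filter
open scoped Classical ENNReal

namespace RWHitting

/-- A weighted graph on a vertex set `V`: a symmetric weight function with
positive finite vertex weights. -/
structure WeightedGraph (V : Type*) where
  w : V → V → ℝ≥0∞
  symm : ∀ x y, w x y = w y x
  vw_pos : ∀ x, 0 < ∑' y, w x y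
  vw_lt_top : ∀ x, ∑' y, w x y < ⊤

namespace WeightedGraph

variable {V : Type*}

/-- The weight of a vertex. -/
noncomputable def vw (G : WeightedGraph V) (x : V) : ℝ≥0∞ := ∑' y, G.w x y

/-- The weight of a vertex set. -/
noncomputable def setWeight (G : WeightedGraph V) (z : Set V) : ℝ≥0∞ := ∑' x : z, G.vw x

/-- `G.distGE o z m` : every path of positive-weight steps from `o` into `z` has length `≥ m`. -/
def distGE (G : WeightedGraph V) (o : V) (z : Set V) (m : ℕ) : Prop :=
  ∀ (k : ℕ) (p : ℕ → V), p 0 = o → (∀ i, i < k → 0 < G.w (p i) (p (i+1))) → p k ∈ z → m ≤ k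

/-- Transition probabilities of the random walk on `G`. -/
noncomputable def trans (G : WeightedGraph V) (x y : V) : ℝ≥0∞ := G.w x y / G.vw x

/-- Graph distance (as an extended nonneg real). -/
noncomputable def edist (G : WeightedGraph V) (x y : V) : ℝ≥0∞ :=
  ⨅ (k : ℕ) (_ : ∃ p : ℕ → V, p 0 = x ∧ p k = y ∧ ∀ i, i < k → 0 < G.w (p i) (p (i+1))),
    (k : ℝ≥0∞)

/-- Total weight of the edges at distance `n` from `o` (each non-loop edge counted in both
orientations). -/
noncomputable def boundaryWeight (G : WeightedGraph V) (o : V) (n : ℕ) : ℝ≥0∞ :=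
  ∑' q : V × V, if min (G.edist o q.1) (G.edist o q.2) = (n : ℝ≥0∞) then G.w q.1 q.2 else 0

end WeightedGraph

variable {V : Type*}

/-- `μ` is the law of the random walk on `G` started at `o`. -/
def IsRandomWalk [MeasurableSpace V] (G : WeightedGraph V) (o : V)
    (μ : Measure (ℕ → V)) : Prop :=
  IsProbabilityMeasure μ ∧
  ∀ (k : ℕ) (x : Fin (k+1) → V),
    μ {ω | ∀ i : Fin (k+1), ω (i : ℕ) = x i}
      = (if x 0 = o then 1 else 0) * ∏ i : Fin k, G.trans (x i.castSucc) (x i.succ)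

/-- First hitting time of the set `z` (`∞` if `z` is never visited). -/
noncomputable def hitTime (z : Set V) (ω : ℕ → V) : ℝ≥0∞ :=
  ⨅ (k : ℕ) (_ : ω k ∈ z), (k : ℝ≥0∞)

/-- Expected hitting time of `z`. -/
noncomputable def expHit [MeasurableSpace V] (μ : Measure (ℕ → V)) (z : Set V) : ℝ≥0∞ :=
  ∫⁻ ω, hitTime z ω ∂μ

/-- Number of visits to `o` (counting time 0) strictly before hitting `z`. -/
noncomputable def visitsBefore (z : Set V) (o : V) (ω : ℕ → V) : ℝ≥0∞ :=
  ∑' k : ℕ, if ω k = o ∧ (k : ℝ≥0∞) < hitTime z ω then 1 else 0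

/-- Effective resistance between `o` and `z`, defined probabilistically via the random walk
law `μ`:  `w_o r_{oz}` is the expected number of visits to `o` before hitting `z`. -/
noncomputable def resistance [MeasurableSpace V] (G : WeightedGraph V) (o : V) (z : Set V)
    (μ : Measure (ℕ → V)) : ℝ≥0∞ :=
  (∫⁻ ω, visitsBefore z o ω ∂μ) / G.vw o

/-- One-step transition probabilities for the biased simple random walk on `ℤ`
with odds `1 : g` of going left/right. -/
noncomputable def biasedStep (g : ℝ) (a b : ℤ) : ℝ≥0∞ :=
  if b = a + 1 then ENNReal.ofReal (g / (g+1))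
  else if b = a - 1 then ENNReal.ofReal (1 / (g+1)) else 0

/-- `ν` is the law of the biased simple random walk on `ℤ` started at `0`,
stepping right with probability `g/(g+1)` and left with probability `1/(g+1)`. -/
def IsBiasedWalk (g : ℝ) (ν : Measure (ℕ → ℤ)) : Prop :=
  IsProbabilityMeasure ν ∧
  ∀ (k : ℕ) (x : Fin (k+1) → ℤ),
    ν {ω | ∀ i : Fin (k+1), ω (i : ℕ) = x i}
      = (if x 0 = 0 then 1 else 0) * ∏ i : Fin k, biasedStep g (x i.castSucc) (x i.succ)

/-- `e^{-λ t}` for an extended-real time `t`, with the convention `e^{-λ ∞} = 0`. -/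
noncomputable def expNeg (lam : ℝ) (t : ℝ≥0∞) : ℝ≥0∞ :=
  if t = ⊤ then 0 else ENNReal.ofReal (Real.exp (-lam * t.toReal))

section RealInequality

/-- The tangent-line bound, in the variable `log (p / q)`, for `(p + q) / (p - q)` at the point
`log g`. -/
lemma mul_tangent_le_add {g p q : ℝ} (hg : 1 < g) (hq : 0 < q) (hqp : q < p) :
    (p - q) * ((g + 1) / (g - 1) + 2 * g / (g - 1) ^ 2 * Real.log g
      + 2 * g / (g - 1) ^ 2 * (Real.log q - Real.log p)) ≤ p + q := by
  have hp : 0 < p := hq.trans hqp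
  have hg0 : 0 < g := by linarith
  have hg1 : 0 < g - 1 := by linarith
  have hlog : Real.log q - Real.log p + Real.log g ≤ q * g / p - 1 := by
    rw [← Real.log_div hq.ne' hp.ne', ← Real.log_mul (div_pos hq hp).ne' hg0.ne',
      div_mul_eq_mul_div]
    exact Real.log_le_sub_one_of_pos (by positivity)
  have hK : 0 ≤ 2 * g / (g - 1) ^ 2 := by positivity
  have h1 : (g + 1) / (g - 1) + 2 * g / (g - 1) ^ 2 * Real.log g
      + 2 * g / (g - 1) ^ 2 * (Real.log q - Real.log p)
      ≤ (g + 1) / (g - 1) + 2 * g / (g - 1) ^ 2 * (q * g / p - 1) := by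
    nlinarith [mul_le_mul_of_nonneg_left hlog hK]
  refine (mul_le_mul_of_nonneg_left h1 (by linarith)).trans ?_
  have h2 : p + q - (p - q) * ((g + 1) / (g - 1) + 2 * g / (g - 1) ^ 2 * (q * g / p - 1))
      = 2 * (q * g - p) ^ 2 / (p * (g - 1) ^ 2) := by
    field_simp
    ring
  have h3 : 0 ≤ 2 * (q * g - p) ^ 2 / (p * (g - 1) ^ 2) := by positivity
  linarith

variable {V : Type*}

lemma summable_mul_of_abs_le {ι : Type*} {j f : ι → ℝ} {C : ℝ} (hj : Summable j)
    (hf : ∀ p, |f p| ≤ C) : Summable fun p => j p * f p := by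
  refine Summable.of_norm_bounded (hj.abs.mul_right C) fun p => ?_
  rw [norm_mul, Real.norm_eq_abs, Real.norm_eq_abs]
  exact mul_le_mul_of_nonneg_left (hf p) (abs_nonneg _)

/-- Summation by parts for a unit flow from `o` to `z`. -/
lemma tsum_flow_mul {j : V → V → ℝ} {o : V} {z : Set V}
    (hj : Summable fun p : V × V => j p.1 p.2) (hanti : ∀ x y, j x y = -j y x)
    (hdiv : ∀ x, x ∉ z → ∑' y, j x y = if x = o then 1 else 0) (ho : o ∉ z)
    {f : V → ℝ} {C c : ℝ} (hf : ∀ x, |f x| ≤ C) (hc : ∀ x ∈ z, f x = c) :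
    ∑' p : V × V, j p.1 p.2 * f p.1 = f o - c := by
  have hzero : ∑' p : V × V, j p.1 p.2 = 0 := by
    have h : ∑' p : V × V, j p.1 p.2 = -∑' p : V × V, j p.1 p.2 := by
      rw [← tsum_neg, ← (Equiv.prodComm V V).tsum_eq fun p : V × V => j p.1 p.2]
      exact tsum_congr fun p => hanti _ _
    linarith
  have hs1 : Summable fun p : V × V => j p.1 p.2 * f p.1 :=
    summable_mul_of_abs_le hj fun p => hf p.1
  have hs2 : Summable fun p : V × V => j p.1 p.2 * c := hj.mul_right c
  have hs3 : Summable fun p : V × V => j p.1 p.2 * (f p.1 - c) := by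
    simpa only [mul_sub] using hs1.sub hs2
  calc ∑' p : V × V, j p.1 p.2 * f p.1
      = ∑' p : V × V, j p.1 p.2 * (f p.1 - c) := by
        simp only [mul_sub]
        rw [hs1.tsum_sub hs2, tsum_mul_right, hzero, zero_mul, sub_zero]
    _ = ∑' x, ∑' y, j x y * (f x - c) := hs3.tsum_prod
    _ = ∑' x, (∑' y, j x y) * (f x - c) := by simp only [tsum_mul_right]
    _ = (∑' y, j o y) * (f o - c) := by
        refine tsum_eq_single o fun x hx => ?_
        by_cases hz : x ∈ z
        · rw [hc x hz, sub_self, mul_zero]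
        · rw [hdiv x hz, if_neg hx, zero_mul]
    _ = f o - c := by rw [hdiv o ho, if_pos rfl, one_mul]

/-- A potential on `V`: away from `o` and `z` it is `α * d x + K * log (v x)`, truncated below
at `m`, while its values at `o` and on `z` are prescribed. -/
noncomputable def potential (o : V) (z : Set V) (v : V → ℝ) (d : V → ℕ) (α K Θo Θz m : ℝ)
    (x : V) : ℝ :=
  if x = o then Θo else if x ∈ z then Θz
  else if 0 < v x then max m (α * d x + K * Real.log (v x)) else m

lemma exists_abs_potential_le {o : V} {z : Set V} {v : V → ℝ} {d : V → ℕ} {n : ℕ}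
    {α K Θo Θz m : ℝ} (hα : 0 ≤ α) (hK : 0 ≤ K) (hvo : ∀ x, v x ≤ v o) (hdn : ∀ x, d x ≤ n) :
    ∃ C, ∀ x, |potential o z v d α K Θo Θz m x| ≤ C := by
  refine ⟨|Θo| + |Θz| + |m| + |α * n + K * Real.log (v o)|, fun x => ?_⟩
  have h1 := abs_nonneg Θo
  have h2 := abs_nonneg Θz
  have h3 := abs_nonneg m
  have h4 := abs_nonneg (α * n + K * Real.log (v o))
  unfold potential
  split_ifs with h h' hv
  · linarith
  · linarith
  · have hle : α * d x + K * Real.log (v x) ≤ α * n + K * Real.log (v o) := by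
      have : (d x : ℝ) ≤ n := by exact_mod_cast hdn x
      have := Real.log_le_log hv (hvo x)
      gcongr
    refine abs_le.2 ⟨?_, ?_⟩
    · have := le_max_left m (α * d x + K * Real.log (v x))
      have := neg_abs_le m
      linarith
    · refine max_le ?_ ?_
      · have := le_abs_self m
        linarith
      · have := le_abs_self (α * n + K * Real.log (v o))
        linarith
  · linarith

lemma edge_bound_of_interior {o : V} {z : Set V} {v : V → ℝ} {d : V → ℕ} {g α Θo Θz m : ℝ}
    {x y : V} (hg : 1 < g) (hv : ∀ x, 0 ≤ v x)
    (hα : α = (g + 1) / (g - 1) + 2 * g / (g - 1) ^ 2 * Real.log g)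
    (hx : x ≠ o) (hxz : x ∉ z) (hy : y ≠ o) (hyz : y ∉ z) (hd : d y ≤ d x + 1)
    (hxy : v y ≤ v x) :
    (v x - v y) * (potential o z v d α (2 * g / (g - 1) ^ 2) Θo Θz m y
      - potential o z v d α (2 * g / (g - 1) ^ 2) Θo Θz m x) ≤ v x + v y := by
  rcases hxy.eq_or_lt with h | hlt
  · rw [h, sub_self, zero_mul]
    exact add_nonneg (hv x) (hv x)
  have hsum : 0 ≤ v x + v y := add_nonneg (hv x) (hv y)
  have hvx : 0 < v x := (hv y).trans_lt hlt
  by_cases hvy : 0 < v y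
  · simp only [potential, if_neg hx, if_neg hxz, if_neg hy, if_neg hyz, if_pos hvx, if_pos hvy]
    set K := 2 * g / (g - 1) ^ 2 with hK
    have hα0 : 0 ≤ α := by
      have := Real.log_nonneg hg.le
      have : 0 < g - 1 := by linarith
      rw [hα]
      positivity
    have hstep : α * d y + K * Real.log (v y) - (α * d x + K * Real.log (v x))
        ≤ α + K * (Real.log (v y) - Real.log (v x)) := by
      have : (d y : ℝ) ≤ d x + 1 := by exact_mod_cast hd
      nlinarith
    have hmain := mul_tangent_le_add hg hvy hlt
    rw [← hK, ← hα] at hmain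
    rcases le_total (α * d y + K * Real.log (v y)) m with h | h
    · rw [max_eq_left h]
      have := le_max_left m (α * d x + K * Real.log (v x))
      nlinarith
    · rw [max_eq_right h]
      have := le_max_right m (α * d x + K * Real.log (v x))
      refine le_trans (mul_le_mul_of_nonneg_left ?_ (sub_pos.2 hlt).le) hmain
      linarith
  · simp only [potential, if_neg hx, if_neg hxz, if_neg hy, if_neg hyz, if_pos hvx, if_neg hvy]
    have := le_max_left m (α * d x + 2 * g / (g - 1) ^ 2 * Real.log (v x))
    nlinarith

lemma edge_bound_of_final {o : V} {z : Set V} {v : V → ℝ} {d : V → ℕ} {n : ℕ}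
    {α K Θo Θz m wz : ℝ} {x y : V} (hv : ∀ x, 0 ≤ v x) (hα : 0 ≤ α) (hK : 0 ≤ K) (hwz : 0 < wz)
    (hΘz : Θz = 1 + α * n - K * Real.log wz)
    (hx : x ≠ o) (hxz : x ∉ z) (hy : y ≠ o) (hyz : y ∈ z) (hd : n ≤ d x) :
    K * (v x - 1 / wz) ≤ v x - v x * (potential o z v d α K Θo Θz m y
      - potential o z v d α K Θo Θz m x) := by
  rcases (hv x).eq_or_lt with h | hvx
  · rw [← h]
    have : 0 ≤ K * (1 / wz) := by positivity
    linarith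
  simp only [potential, if_neg hx, if_neg hxz, if_neg hy, if_pos hyz, if_pos hvx]
  have h1 := le_max_right m (α * d x + K * Real.log (v x))
  have hlog := Real.one_sub_inv_le_log_of_pos (mul_pos hwz hvx)
  rw [Real.log_mul hwz.ne' hvx.ne'] at hlog
  have hdn : (n : ℝ) ≤ d x := by exact_mod_cast hd
  have h2 : α * n ≤ α * d x := mul_le_mul_of_nonneg_left hdn hα
  have h3 : K * (1 - (wz * v x)⁻¹) ≤ 1 - (Θz - max m (α * d x + K * Real.log (v x))) := by
    have := mul_le_mul_of_nonneg_left hlog hK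
    rw [hΘz]
    linarith
  have h4 := mul_le_mul_of_nonneg_left h3 hvx.le
  have h5 : v x * (K * (1 - (wz * v x)⁻¹)) = K * (v x - 1 / wz) := by
    field_simp
  linarith

lemma edge_bound_of_initial {o : V} {z : Set V} {v : V → ℝ} {d : V → ℕ}
    {α K Θo Θz m W : ℝ} {y : V} (hv : ∀ x, 0 ≤ v x) (hvo : ∀ x, v x ≤ v o) (hα : 0 ≤ α)
    (hK : 0 < K) (hW : 0 < W) (hm : m = α - K + K * Real.log (K / W))
    (hΘo : Θo = α - K + K * Real.log (K / W) - 1)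
    (hy : y ≠ o) (hyz : y ∉ z) (hd : d y ≤ 1) :
    v o - (v o - v y) * (W * v o - 1) - 1 / W ≤ v o + v y
      - (v o - v y) * (potential o z v d α K Θo Θz m y - potential o z v d α K Θo Θz m o) := by
  have hΘ : potential o z v d α K Θo Θz m y ≤ α - K + K * Real.log (K / W) + W * v y := by
    have hWv : 0 ≤ W * v y := mul_nonneg hW.le (hv y)
    simp only [potential, if_neg hy, if_neg hyz]
    split_ifs with hvy
    · refine max_le (by linarith) ?_
      have hlog := Real.log_le_sub_one_of_pos (show 0 < v y / (K / W) by positivity)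
      rw [Real.log_div hvy.ne' (by positivity)] at hlog
      have h1 := mul_le_mul_of_nonneg_left hlog hK.le
      have h2 : K * (v y / (K / W) - 1) = W * v y - K := by
        field_simp
      have hd1 : (d y : ℝ) ≤ 1 := by exact_mod_cast hd
      nlinarith
    · linarith
  have hΘ' : potential o z v d α K Θo Θz m o = Θo := if_pos rfl
  have hdiff : potential o z v d α K Θo Θz m y - potential o z v d α K Θo Θz m o
      ≤ 1 + W * v y := by
    rw [hΘ']
    linarith
  have h1 := mul_le_mul_of_nonneg_left hdiff (sub_nonneg.2 (hvo y))
  have h2 : 0 ≤ W * ((v o - v y) - 1 / W) ^ 2 := by positivity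
  have h3 : W * ((v o - v y) - 1 / W) ^ 2
      = W * (v o - v y) ^ 2 - 2 * (v o - v y) + 1 / W := by
    field_simp
    ring
  nlinarith [hv y]

/-- The lower bound on `∑ x, W x * v x` for a function `v` whose gradient with respect to the edge
weights `a` is a unit flow from `o` to a set `z`, in terms of a function `d` that plays the role
of the graph distance from `o`. -/
theorem tsum_potential_lower_bound {a : V → V → ℝ} {v : V → ℝ} {d : V → ℕ} {o : V} {z : Set V}
    {n : ℕ} {g W wz : ℝ} (hn : 1 ≤ n) (hg : 1 < g)
    (ha : ∀ x y, 0 ≤ a x y) (hsymm : ∀ x y, a x y = a y x)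
    (hv : ∀ x, 0 ≤ v x) (hvo : ∀ x, v x ≤ v o) (hvz : ∀ x ∈ z, v x = 0) (ho : o ∉ z)
    (hav : Summable fun p : V × V => a p.1 p.2 * v p.1)
    (hdiv : ∀ x, x ∉ z → ∑' y, a x y * (v x - v y) = if x = o then 1 else 0)
    (hW : HasSum (a o) W) (hW0 : 0 < W)
    (hwz : HasSum (fun p : V × V => if p.1 ∈ z then a p.1 p.2 else 0) wz)
    (hdn : ∀ x, d x ≤ n) (hdo : d o = 0) (hd : ∀ x y, a x y ≠ 0 → d y ≤ d x + 1)
    (hdz : ∀ x y, a x y ≠ 0 → y ∈ z → n ≤ d x)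
    (hsol : (g - 1) ^ 2 * g ^ ((n : ℝ) - 2) = 2 * wz / W) :
    n * (g + 1) / (g - 1) + 1 ≤ ∑' p : V × V, a p.1 p.2 * v p.1 := by
  have hg0 : 0 < g := by linarith
  have hg1 : 0 < g - 1 := by linarith
  have hwz0 : 0 < wz := by
    have h : 0 < 2 * wz / W := hsol ▸ (by positivity)
    have := (div_pos_iff_of_pos_right hW0).1 h
    linarith
  set K := 2 * g / (g - 1) ^ 2 with hK
  have hK0 : 0 < K := by positivity
  obtain ⟨α, hα⟩ : ∃ α, α = (g + 1) / (g - 1) + K * Real.log g := ⟨_, rfl⟩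
  have hα0 : 0 ≤ α := by
    have := Real.log_nonneg hg.le
    rw [hα]
    positivity
  obtain ⟨m, hm⟩ : ∃ m, m = α - K + K * Real.log (K / W) := ⟨_, rfl⟩
  obtain ⟨Θo, hΘo⟩ : ∃ Θo, Θo = α - K + K * Real.log (K / W) - 1 := ⟨_, rfl⟩
  obtain ⟨Θz, hΘz⟩ : ∃ Θz, Θz = 1 + α * n - K * Real.log wz := ⟨_, rfl⟩
  set j : V → V → ℝ := fun x y => a x y * (v x - v y) with hj
  set Θ := potential o z v d α K Θo Θz m with hΘ
  obtain ⟨C, hC⟩ : ∃ C, ∀ x, |Θ x| ≤ C := exists_abs_potential_le hα0 hK0.le hvo hdn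
  have hav' : Summable fun p : V × V => a p.1 p.2 * v p.2 := by
    refine ((Equiv.prodComm V V).summable_iff.2 hav).congr fun p => ?_
    simp [hsymm p.1 p.2]
  have hjs : Summable fun p : V × V => j p.1 p.2 := by
    simpa only [hj, mul_sub] using hav.sub hav'
  have hanti : ∀ x y, j x y = -j y x := fun x y => by
    simp only [hj, hsymm x y]
    ring
  -- the corrections at the two ends of the flow, which sum to zero
  set A : V → V → ℝ := fun x y =>
    if x = o then a x y * v o - j x y * (W * v o - 1) - a x y / W else 0 with hA
  set B : V → V → ℝ := fun x y => if x ∈ z then K * (-j x y - a x y / wz) else 0 with hB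
  have hA_sum : HasSum (fun p : V × V => A p.1 p.2) 0 := by
    have hjo : HasSum (j o) 1 := by
      have h := (hjs.prod_factor o).hasSum
      rwa [hdiv o ho, if_pos rfl] at h
    have h := ((hW.mul_right (v o)).sub (hjo.mul_right (W * v o - 1))).sub (hW.div_const W)
    have hval : W * v o - 1 * (W * v o - 1) - W / W = 0 := by
      rw [div_self hW0.ne']
      ring
    rw [hval] at h
    have hinj : Function.Injective fun y : V => (o, y) := Prod.mk_right_injective o
    refine (hinj.hasSum_iff ?_).1 ?_
    · rintro ⟨x, y⟩ hxy
      refine if_neg fun hx => hxy ⟨y, ?_⟩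
      simp only at hx
      rw [hx]
    · have hcongr : (fun p : V × V => A p.1 p.2) ∘ (fun y => (o, y))
          = fun y => a o y * v o - j o y * (W * v o - 1) - a o y / W := funext fun y => if_pos rfl
      rw [hcongr]
      exact h
  have hB_sum : HasSum (fun p : V × V => B p.1 p.2) 0 := by
    have hbound : ∀ x, |(if x ∈ z then (1 : ℝ) else 0)| ≤ 1 := fun x => by
      split_ifs <;> simp
    have h1 := tsum_flow_mul (j := j) hjs hanti hdiv ho
      (f := fun x => if x ∈ z then (1 : ℝ) else 0) (c := 1) hbound (fun x hx => if_pos hx)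
    have h2 := (summable_mul_of_abs_le hjs fun p => hbound p.1).hasSum
    rw [h1] at h2
    have h := ((h2.neg.sub (hwz.div_const wz))).mul_left K
    have hval : K * (-((if o ∈ z then 1 else 0) - 1) - wz / wz) = 0 := by
      rw [if_neg ho, div_self hwz0.ne']
      ring
    rw [hval] at h
    have hcongr : (fun p : V × V => B p.1 p.2) = fun p : V × V =>
        K * (-(j p.1 p.2 * if p.1 ∈ z then 1 else 0)
          - (if p.1 ∈ z then a p.1 p.2 else 0) / wz) := by
      funext p
      simp only [hB]
      split_ifs <;> ring
    rw [hcongr]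
    exact h
  have hne : ∀ x, x ∈ z → x ≠ o := fun x hx h => ho (h ▸ hx)
  have key_initial : ∀ y, A o y + A y o + (B o y + B y o) ≤
      a o y * (v o + v y) - j o y * (Θ y - Θ o) := by
    intro y
    rcases (ha o y).eq_or_lt with h0 | hpos
    · have h0' : a y o = 0 := by rw [hsymm, ← h0]
      simp [hA, hB, hj, ← h0, h0']
    by_cases hy : y = o
    · rw [hy] at hpos ⊢
      have : 0 ≤ a o o / W := by positivity
      simp only [hA, hB, hj, if_pos, if_neg ho, sub_self, mul_zero, zero_mul]
      linarith
    · have hyz : y ∉ z := fun h => by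
        have := hdz o y hpos.ne' h
        omega
      have hdy : d y ≤ 1 := by
        have := hd o y hpos.ne'
        omega
      have h := edge_bound_of_initial (Θz := Θz) hv hvo hα0 hK0 hW0 hm hΘo hy hyz hdy
      rw [← hΘ] at h
      have := mul_le_mul_of_nonneg_left h hpos.le
      simp only [hA, hB, hj, if_pos, if_neg hy, if_neg ho, if_neg hyz]
      have e : a o y / W = a o y * (1 / W) := by ring
      rw [e]
      linarith
  have key_final : ∀ x y, x ∉ z → x ≠ o → y ∈ z → A x y + A y x + (B x y + B y x) ≤
      a x y * (v x + v y) - j x y * (Θ y - Θ x) := by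
    intro x y hxz hx hyz
    rcases (ha x y).eq_or_lt with h0 | hpos
    · have h0' : a y x = 0 := by rw [hsymm, ← h0]
      simp [hA, hB, hj, ← h0, h0']
    have h := edge_bound_of_final (Θo := Θo) (m := m) hv hα0 hK0.le hwz0 hΘz hx hxz (hne y hyz)
      hyz (hdz x y hpos.ne' hyz)
    rw [← hΘ] at h
    have := mul_le_mul_of_nonneg_left h hpos.le
    simp only [hA, hB, hj, if_neg hx, if_neg (hne y hyz), if_neg hxz, if_pos hyz, hsymm y x,
      hvz y hyz]
    have e : a x y / wz = a x y * (1 / wz) := by ring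
    rw [e]
    linarith
  have key_interior : ∀ x y, x ∉ z → x ≠ o → y ∉ z → y ≠ o → v y ≤ v x →
      A x y + A y x + (B x y + B y x) ≤ a x y * (v x + v y) - j x y * (Θ y - Θ x) := by
    intro x y hxz hx hyz hy hxy
    simp only [hA, hB, hj, if_neg hx, if_neg hy, if_neg hxz, if_neg hyz]
    rcases (ha x y).eq_or_lt with h0 | hpos
    · simp [← h0]
    have h := edge_bound_of_interior (Θo := Θo) (Θz := Θz) (m := m) hg hv hα hx hxz hy hyz
      (hd x y hpos.ne') hxy
    rw [← hK, ← hΘ] at h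
    have := mul_le_mul_of_nonneg_left h hpos.le
    linarith
  have key : ∀ x y, A x y + A y x + (B x y + B y x) ≤
      a x y * (v x + v y) - j x y * (Θ y - Θ x) := by
    intro x y
    have hswap : a y x * (v y + v x) - j y x * (Θ x - Θ y)
        = a x y * (v x + v y) - j x y * (Θ y - Θ x) := by
      rw [hanti y x, hsymm y x]
      ring
    by_cases hx : x = o
    · rw [hx]
      exact key_initial y
    by_cases hy : y = o
    · have := key_initial x
      rw [← hy] at this
      linarith
    by_cases hxz : x ∈ z <;> by_cases hyz : y ∈ z
    · have h1 : 0 ≤ K * (a x y / wz) := by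
        have := ha x y
        positivity
      simp only [hA, hB, hj, if_neg hx, if_neg hy, if_pos hxz, if_pos hyz, hvz x hxz, hvz y hyz,
        hsymm y x]
      linarith
    · have := key_final y x hyz hy hxz
      linarith
    · exact key_final x y hxz hx hyz
    · rcases le_total (v y) (v x) with h | h
      · exact key_interior x y hxz hx hyz hy h
      · have := key_interior y x hyz hy hxz hx h
        linarith
  have hΘs : Summable fun p : V × V => j p.1 p.2 * Θ p.1 :=
    summable_mul_of_abs_le hjs fun p => hC p.1
  have hΘsum : ∑' p : V × V, j p.1 p.2 * Θ p.1 = Θo - Θz := by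
    have h := tsum_flow_mul hjs hanti hdiv ho hC (c := Θz) fun x hx => by
      rw [hΘ, potential, if_neg (hne x hx), if_pos hx]
    rw [h, hΘ, potential, if_pos rfl]
  have swap_hasSum : ∀ (f : V → V → ℝ) (s : ℝ), HasSum (fun p : V × V => f p.1 p.2) s →
      HasSum (fun p : V × V => f p.2 p.1) s :=
    fun f s hf => (Equiv.prodComm V V).hasSum_iff.2 hf
  have hE := hav.hasSum
  have hE' := swap_hasSum (fun x y => a x y * v x) _ hE
  have hJ := hΘs.hasSum
  rw [hΘsum] at hJ
  have hJ' := swap_hasSum (fun x y => j x y * Θ x) _ hJ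
  have hle := hasSum_le (fun p : V × V => (key p.1 p.2).trans_eq
      (show _ = a p.1 p.2 * v p.1 + a p.2 p.1 * v p.2
        + (j p.2 p.1 * Θ p.2 + j p.1 p.2 * Θ p.1) by
      rw [hanti p.2 p.1, hsymm p.2 p.1]
      ring))
    ((hA_sum.add (swap_hasSum A _ hA_sum)).add (hB_sum.add (swap_hasSum B _ hB_sum)))
    ((hE.add hE').add (hJ'.add hJ))
  have hlogs : Real.log wz - Real.log W = (n - 1) * Real.log g - Real.log K := by
    have h1 : wz / W = g ^ ((n : ℝ) - 1) / K := by
      have h2 : g ^ ((n : ℝ) - 1) = g ^ ((n : ℝ) - 2) * g := by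
        rw [← Real.rpow_add_one hg0.ne']
        congr 1
        ring
      have h3 : wz / W = (g - 1) ^ 2 * g ^ ((n : ℝ) - 2) / 2 := by
        rw [hsol]
        ring
      rw [h2, h3, hK]
      field_simp
    rw [← Real.log_div hwz0.ne' hW0.ne', h1, Real.log_div (by positivity) hK0.ne',
      Real.log_rpow hg0]
  have hlogK : Real.log (K / W) = Real.log K - Real.log W := Real.log_div hK0.ne' hW0.ne'
  have hbound : Θz - Θo = 2 + K + (n - 1) * ((g + 1) / (g - 1)) := by
    rw [hΘz, hΘo, hlogK, hα]
    linear_combination (-K) * hlogs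
  have hKφ : (g + 1) / (g - 1) ≤ 1 + K := by
    have h : 1 + K - (g + 1) / (g - 1) = 2 / (g - 1) ^ 2 := by
      rw [hK]
      field_simp
      ring
    have : 0 ≤ 2 / (g - 1) ^ 2 := by positivity
    linarith
  rw [mul_div_assoc]
  linarith

end RealInequality

lemma hasSum_toReal_tsum {ι : Type*} {f : ι → ℝ≥0∞} (h : ∑' i, f i ≠ ⊤) :
    HasSum (fun i => (f i).toReal) (∑' i, f i).toReal := by
  rw [ENNReal.tsum_toReal_eq (ENNReal.ne_top_of_tsum_ne_top h)]
  exact ENNReal.hasSum_toReal h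

namespace WeightedGraph

variable {V : Type*}

lemma vw_ne_zero (G : WeightedGraph V) (x : V) : G.vw x ≠ 0 := (G.vw_pos x).ne'

lemma vw_ne_top (G : WeightedGraph V) (x : V) : G.vw x ≠ ⊤ := (G.vw_lt_top x).ne

lemma vw_mul_trans (G : WeightedGraph V) (x y : V) :
    G.vw x * G.trans x y = G.w x y :=
  ENNReal.mul_div_cancel (G.vw_ne_zero x) (G.vw_ne_top x)

end WeightedGraph

section RandomWalk

variable {V : Type*}

/-- The event that the walk is at `y` at time `k` and has not visited `z` up to time `k`. -/
def aliveAt (z : Set V) (k : ℕ) (y : V) : Set (ℕ → V) := {ω | ω k = y ∧ ∀ i ≤ k, ω i ∉ z}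

lemma measure_eq_tsum_inter_preimage_singleton {Ω ι : Type*} [MeasurableSpace Ω] [Countable ι]
    [MeasurableSpace ι] [MeasurableSingletonClass ι] (μ : Measure Ω) {f : Ω → ι}
    (hf : Measurable f) {S : Set Ω} (hS : MeasurableSet S) :
    μ S = ∑' i, μ (S ∩ f ⁻¹' {i}) := by
  have hdisj : Pairwise (Function.onFun Disjoint fun i => S ∩ f ⁻¹' {i}) := by
    intro i i' h
    refine Set.disjoint_left.2 fun ω h1 h2 => h ?_
    exact h1.2.symm.trans h2.2
  rw [← measure_iUnion hdisj fun i => hS.inter (hf (measurableSet_singleton i)),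
    ← Set.inter_iUnion, ← Set.preimage_iUnion, Set.iUnion_of_singleton, Set.preimage_univ,
    Set.inter_univ]

variable [MeasurableSpace V] {G : WeightedGraph V} {o : V} {μ : Measure (ℕ → V)}

lemma measure_aliveAt_of_mem {z : Set V} (k : ℕ) {y : V} (hy : y ∈ z) :
    μ (aliveAt z k y) = 0 := by
  have : aliveAt z k y = ∅ :=
    Set.eq_empty_iff_forall_notMem.2 fun ω hω => hω.2 k le_rfl (hω.1.symm ▸ hy)
  rw [this, measure_empty]

lemma IsRandomWalk.measure_aliveAt_zero (hμ : IsRandomWalk G o μ) {z : Set V} (ho : o ∉ z)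
    (y : V) : μ (aliveAt z 0 y) = if y = o then 1 else 0 := by
  have h := hμ.2 0 fun _ => y
  simp only [Finset.univ_eq_empty, Finset.prod_empty, mul_one] at h
  by_cases hy : y ∈ z
  · have hne : y ≠ o := fun h => ho (h ▸ hy)
    have : aliveAt z 0 y = ∅ :=
      Set.eq_empty_iff_forall_notMem.2 fun ω hω => hω.2 0 le_rfl (hω.1.symm ▸ hy)
    rw [this, measure_empty, if_neg hne]
  · rw [← h]
    congr 1
    ext ω
    simp only [aliveAt, Set.mem_ofPred_eq, Nat.le_zero, forall_eq]
    constructor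
    · rintro ⟨h1, -⟩ i
      have : (i : ℕ) = 0 := by omega
      rw [this, h1]
    · intro h1
      have := h1 0
      simp only [Fin.val_zero] at this
      exact ⟨this, this ▸ hy⟩

lemma IsRandomWalk.measure_cylinder_succ (hμ : IsRandomWalk G o μ) (k : ℕ) (p : Fin (k + 1) → V)
    (y : V) :
    μ {ω | (∀ i : Fin (k + 1), ω i = p i) ∧ ω (k + 1) = y}
      = μ {ω | ∀ i : Fin (k + 1), ω i = p i} * G.trans (p (Fin.last k)) y := by
  have h := hμ.2 (k + 1) (Fin.snoc p y)
  have hset : {ω : ℕ → V | ∀ i : Fin (k + 1 + 1), ω i = (Fin.snoc p y : Fin (k + 1 + 1) → V) i}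
      = {ω | (∀ i : Fin (k + 1), ω i = p i) ∧ ω (k + 1) = y} := by
    ext ω
    simp only [Set.mem_ofPred_eq]
    rw [Fin.forall_fin_succ']
    simp
  have h0 : (Fin.snoc p y : Fin (k + 1 + 1) → V) 0 = p 0 := by
    rw [← Fin.castSucc_zero, Fin.snoc_castSucc]
  rw [hset, h0, Fin.prod_univ_castSucc] at h
  rw [h, hμ.2 k p, mul_assoc]
  simp only [Fin.succ_castSucc, Fin.snoc_castSucc, Fin.succ_last, Fin.snoc_last]

/-- The expected number of visits to `y` before hitting `z`. -/
noncomputable def green (μ : Measure (ℕ → V)) (z : Set V) (y : V) : ℝ≥0∞ :=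
  ∑' k, μ (aliveAt z k y)

/-- The voltage at `y` when a unit current flows from the starting point of the walk to `z`. -/
noncomputable def voltage (G : WeightedGraph V) (μ : Measure (ℕ → V)) (z : Set V) (y : V) :
    ℝ≥0∞ := green μ z y / G.vw y

lemma vw_mul_voltage (z : Set V) (x : V) : G.vw x * voltage G μ z x = green μ z x :=
  ENNReal.mul_div_cancel (G.vw_ne_zero x) (G.vw_ne_top x)

lemma voltage_of_mem {z : Set V} {x : V} (hx : x ∈ z) : voltage G μ z x = 0 := by
  simp [voltage, green, measure_aliveAt_of_mem _ hx]

lemma tsum_w_mul_voltage (z : Set V) :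
    ∑' p : V × V, G.w p.1 p.2 * voltage G μ z p.1 = ∑' x, green μ z x := by
  rw [ENNReal.tsum_prod']
  refine tsum_congr fun x => ?_
  dsimp only
  rw [ENNReal.tsum_mul_right, ← vw_mul_voltage (G := G), WeightedGraph.vw]

variable [MeasurableSingletonClass V] [Countable V]

lemma measurableSet_aliveAt (z : Set V) (k : ℕ) (y : V) : MeasurableSet (aliveAt z k y) := by
  have h : aliveAt z k y = (fun ω : ℕ → V => ω k) ⁻¹' {y} ∩
      ⋂ i, ⋂ (_ : i ≤ k), (fun ω : ℕ → V => ω i) ⁻¹' zᶜ := by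
    ext ω
    simp [aliveAt]
  rw [h]
  exact (measurable_pi_apply k (measurableSet_singleton y)).inter
    (MeasurableSet.iInter fun i => MeasurableSet.iInter fun _ =>
      measurable_pi_apply i (Set.to_countable _).measurableSet)

lemma tsum_measure_aliveAt_le_expHit (μ : Measure (ℕ → V)) (z : Set V) :
    ∑' k, ∑' y, μ (aliveAt z k y) ≤ expHit μ z := by
  have hmeas : ∀ k, MeasurableSet (⋃ y, aliveAt z k y) := fun k =>
    MeasurableSet.iUnion fun y => measurableSet_aliveAt z k y
  have hsum : ∀ k, ∑' y, μ (aliveAt z k y)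
      = ∫⁻ ω, (⋃ y, aliveAt z k y).indicator (fun _ => 1) ω ∂μ := fun k => by
    rw [lintegral_indicator_const (hmeas k), one_mul, measure_iUnion _ (measurableSet_aliveAt z k)]
    intro x y h
    exact Set.disjoint_left.2 fun ω h1 h2 => h (h1.1.symm.trans h2.1)
  simp only [hsum]
  rw [← lintegral_tsum fun k => (measurable_const.indicator (hmeas k)).aemeasurable]
  refine lintegral_mono fun ω => le_iInf₂ fun m hm => ?_
  have h0 : ∀ k, k ∉ Finset.range m →
      (⋃ y, aliveAt z k y).indicator (fun _ => (1 : ℝ≥0∞)) ω = 0 := by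
    intro k hk
    refine Set.indicator_of_notMem (fun h => ?_) _
    obtain ⟨y, hy⟩ := Set.mem_iUnion.1 h
    exact hy.2 m (by simpa using hk) hm
  rw [tsum_eq_sum h0]
  calc _ ≤ ∑ _k ∈ Finset.range m, (1 : ℝ≥0∞) :=
        Finset.sum_le_sum fun k _ => Set.indicator_le_self' (fun _ _ => zero_le) ω
    _ = m := by simp

lemma IsRandomWalk.measure_aliveAt_inter (hμ : IsRandomWalk G o μ) (z : Set V) (k : ℕ) (x y : V) :
    μ (aliveAt z k x ∩ {ω | ω (k + 1) = y}) = μ (aliveAt z k x) * G.trans x y := by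
  have hf : Measurable fun (ω : ℕ → V) (i : Fin (k + 1)) => ω i :=
    measurable_pi_lambda _ fun i => measurable_pi_apply _
  have hy : MeasurableSet {ω : ℕ → V | ω (k + 1) = y} :=
    (measurable_pi_apply (k + 1) : Measurable fun ω : ℕ → V => ω (k + 1))
      (measurableSet_singleton y)
  rw [measure_eq_tsum_inter_preimage_singleton μ hf ((measurableSet_aliveAt z k x).inter hy),
    measure_eq_tsum_inter_preimage_singleton μ hf (measurableSet_aliveAt z k x),
    ← ENNReal.tsum_mul_right]
  refine tsum_congr fun p => ?_
  have hpre : ∀ ω : ℕ → V, ω ∈ (fun (ω : ℕ → V) (i : Fin (k + 1)) => ω i) ⁻¹' {p} ↔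
      ∀ i : Fin (k + 1), ω i = p i := fun ω => funext_iff
  have hmem : ∀ ω : ℕ → V, (∀ i : Fin (k + 1), ω i = p i) →
      (ω ∈ aliveAt z k x ↔ p (Fin.last k) = x ∧ ∀ i, p i ∉ z) := by
    intro ω hω
    have hlast : ω k = p (Fin.last k) := hω (Fin.last k)
    refine and_congr (by rw [hlast]) ⟨fun h i => ?_, fun h i hi => ?_⟩
    · rw [← hω i]
      exact h i (Nat.lt_succ_iff.1 i.2)
    · have := hω ⟨i, Nat.lt_succ_of_le hi⟩
      simp only at this
      rw [this]
      exact h _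
  by_cases hp : p (Fin.last k) = x ∧ ∀ i, p i ∉ z
  · have h1 : aliveAt z k x ∩ {ω | ω (k + 1) = y} ∩
        (fun (ω : ℕ → V) (i : Fin (k + 1)) => ω i) ⁻¹' {p}
        = {ω | (∀ i : Fin (k + 1), ω i = p i) ∧ ω (k + 1) = y} := by
      ext ω
      rw [Set.mem_inter_iff, hpre]
      exact ⟨fun h => ⟨h.2, h.1.2⟩, fun h => ⟨⟨(hmem ω h.1).2 hp, h.2⟩, h.1⟩⟩
    have h2 : aliveAt z k x ∩ (fun (ω : ℕ → V) (i : Fin (k + 1)) => ω i) ⁻¹' {p}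
        = {ω | ∀ i : Fin (k + 1), ω i = p i} := by
      ext ω
      rw [Set.mem_inter_iff, hpre]
      exact ⟨fun h => h.2, fun h => ⟨(hmem ω h).2 hp, h⟩⟩
    rw [h1, h2, hμ.measure_cylinder_succ, hp.1]
  · have h2 : aliveAt z k x ∩ (fun (ω : ℕ → V) (i : Fin (k + 1)) => ω i) ⁻¹' {p} = ∅ := by
      refine Set.eq_empty_iff_forall_notMem.2 fun ω h => hp ?_
      exact (hmem ω ((hpre ω).1 h.2)).1 h.1
    rw [Set.inter_right_comm, h2, Set.empty_inter, measure_empty, zero_mul]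

lemma IsRandomWalk.measure_aliveAt_succ (hμ : IsRandomWalk G o μ) {z : Set V} (k : ℕ) {y : V}
    (hy : y ∉ z) :
    μ (aliveAt z (k + 1) y) = ∑' x, μ (aliveAt z k x) * G.trans x y := by
  rw [measure_eq_tsum_inter_preimage_singleton μ (measurable_pi_apply k)
    (measurableSet_aliveAt z (k + 1) y)]
  refine tsum_congr fun x => ?_
  rw [← hμ.measure_aliveAt_inter]
  congr 1
  ext ω
  simp only [aliveAt, Set.mem_inter_iff, Set.mem_ofPred_eq, Set.mem_preimage, Set.mem_singleton_iff]
  constructor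
  · rintro ⟨⟨h1, h2⟩, h3⟩
    exact ⟨⟨h3, fun i hi => h2 i (by omega)⟩, h1⟩
  · rintro ⟨⟨h1, h2⟩, h3⟩
    refine ⟨⟨h3, fun i hi => ?_⟩, h1⟩
    rcases Nat.lt_or_ge k i with h | h
    · have : i = k + 1 := by omega
      rw [this, h3]
      exact hy
    · exact h2 i h

lemma IsRandomWalk.green_eq (hμ : IsRandomWalk G o μ) {z : Set V} (ho : o ∉ z) {x : V}
    (hx : x ∉ z) :
    green μ z x = (if x = o then 1 else 0) + ∑' y, G.w x y * voltage G μ z y := by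
  rw [green, tsum_eq_zero_add' ENNReal.summable, hμ.measure_aliveAt_zero ho]
  congr 1
  simp only [hμ.measure_aliveAt_succ _ hx]
  rw [ENNReal.tsum_comm]
  refine tsum_congr fun y => ?_
  rw [ENNReal.tsum_mul_right, ← green, ← vw_mul_voltage (G := G), G.symm x y, ← G.vw_mul_trans]
  ring

lemma IsRandomWalk.voltage_le (hμ : IsRandomWalk G o μ) {z : Set V} (ho : o ∉ z) (x : V) :
    voltage G μ z x ≤ voltage G μ z o := by
  set c := voltage G μ z o with hc
  have key : ∀ (N : ℕ) (y : V), ∑ k ∈ Finset.range N, μ (aliveAt z k y) ≤ c * G.vw y := by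
    intro N
    induction N with
    | zero => simp
    | succ N ih =>
      intro y
      by_cases hy : y ∈ z
      · simp [measure_aliveAt_of_mem _ hy]
      by_cases hyo : y = o
      · rw [hyo, mul_comm, hc, vw_mul_voltage]
        exact ENNReal.sum_le_tsum _
      rw [Finset.sum_range_succ', hμ.measure_aliveAt_zero ho, if_neg hyo, add_zero]
      simp only [hμ.measure_aliveAt_succ _ hy]
      rw [← Summable.tsum_finsetSum fun _ _ => ENNReal.summable]
      calc _ ≤ ∑' x, c * G.w y x := by
            refine ENNReal.tsum_le_tsum fun x => ?_
            rw [← Finset.sum_mul, G.symm y x, ← G.vw_mul_trans, ← mul_assoc]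
            gcongr
            exact ih x
        _ = c * G.vw y := ENNReal.tsum_mul_left
  refine ENNReal.div_le_of_le_mul ?_
  rw [green, ENNReal.tsum_eq_iSup_nat]
  exact iSup_le fun N => key N x

lemma tsum_green_le_expHit (μ : Measure (ℕ → V)) (z : Set V) :
    ∑' x, green μ z x ≤ expHit μ z := by
  simp only [green]
  rw [ENNReal.tsum_comm]
  exact tsum_measure_aliveAt_le_expHit μ z

end RandomWalk

section CappedDist

variable {V : Type*} {G : WeightedGraph V} {o : V} {z : Set V} {n : ℕ} {x y : V}

/-- The lengths of the paths of positive-weight steps from `o` to `x`. -/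
def pathLengths (G : WeightedGraph V) (o x : V) : Set ℕ :=
  {k | ∃ p : ℕ → V, p 0 = o ∧ p k = x ∧ ∀ i, i < k → 0 < G.w (p i) (p (i + 1))}

lemma succ_mem_pathLengths {k : ℕ} (hk : k ∈ pathLengths G o x) (h : 0 < G.w x y) :
    k + 1 ∈ pathLengths G o y := by
  obtain ⟨p, h0, hpk, hp⟩ := hk
  refine ⟨fun i => if i ≤ k then p i else y, by simpa using h0, by simp, fun i hi => ?_⟩
  rcases Nat.lt_succ_iff_lt_or_eq.1 hi with hlt | rfl
  · simpa [hlt.le, Nat.succ_le_of_lt hlt] using hp i hlt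
  · simpa [hpk] using h

/-- The graph distance from `o`, capped at `n`. -/
noncomputable def cappedDist (G : WeightedGraph V) (o : V) (n : ℕ) (x : V) : ℕ :=
  sInf (pathLengths G o x ∪ {n})

lemma cappedDist_mem (G : WeightedGraph V) (o : V) (n : ℕ) (x : V) :
    cappedDist G o n x ∈ pathLengths G o x ∪ {n} :=
  Nat.sInf_mem ⟨n, Or.inr rfl⟩

lemma cappedDist_le : cappedDist G o n x ≤ n := Nat.sInf_le (Or.inr rfl)

lemma cappedDist_self : cappedDist G o n o = 0 :=
  Nat.le_zero.1 (Nat.sInf_le (Or.inl ⟨fun _ => o, rfl, rfl, fun i hi => absurd hi (by omega)⟩))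

lemma cappedDist_le_succ (h : 0 < G.w x y) : cappedDist G o n y ≤ cappedDist G o n x + 1 := by
  rcases cappedDist_mem G o n x with hk | hk
  · exact Nat.sInf_le (Or.inl (succ_mem_pathLengths hk h))
  · have hk : cappedDist G o n x = n := hk
    rw [hk]
    exact cappedDist_le.trans n.le_succ

lemma le_cappedDist_of_distGE (hdist : G.distGE o z (n + 1)) (h : 0 < G.w x y) (hy : y ∈ z) :
    n ≤ cappedDist G o n x := by
  rcases cappedDist_mem G o n x with hk | hk
  · obtain ⟨p, h0, hpk, hp⟩ := succ_mem_pathLengths hk h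
    exact Nat.le_of_succ_le_succ (hdist _ p h0 hp (hpk ▸ hy))
  · exact (show cappedDist G o n x = n from hk).ge

end CappedDist

/-- Lower bound on the expected hitting time in terms of a `g > 1` solving
`(g-1)^2 g^(n-2) = 2 w_z / w_o`. -/
theorem expected_hitting_time_lower_bound
    {V : Type*} [Countable V] [MeasurableSpace V] [MeasurableSingletonClass V]
    (G : WeightedGraph V) (o : V) (z : Set V) (n : ℕ) (g : ℝ)
    (μ : Measure (ℕ → V)) (hμ : IsRandomWalk G o μ)
    (hdist : G.distGE o z (n + 1))
    (hg : 1 < g)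
    (hsol : ENNReal.ofReal ((g - 1) ^ 2 * g ^ ((n : ℝ) - 2)) = 2 * G.setWeight z / G.vw o) :
    ENNReal.ofReal ((n : ℝ) * (g + 1) / (g - 1) + 1) ≤ expHit μ z := by
  have ho : o ∉ z := fun h => by
    have := hdist 0 (fun _ => o) rfl (fun i hi => absurd hi (Nat.not_lt_zero i)) h
    omega
  rcases Nat.eq_zero_or_pos n with rfl | hn
  · have h1 : (1 : ℝ≥0∞) ≤ green μ z o := by
      have h := hμ.measure_aliveAt_zero ho o
      rw [if_pos rfl] at h
      rw [← h]
      exact ENNReal.le_tsum 0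
    simpa using (h1.trans (ENNReal.le_tsum o)).trans (tsum_green_le_expHit μ z)
  rcases eq_or_ne (expHit μ z) ⊤ with htop | htop
  · rw [htop]
    exact le_top
  have hE : ∑' p : V × V, G.w p.1 p.2 * voltage G μ z p.1 ≠ ⊤ := by
    rw [tsum_w_mul_voltage]
    exact ne_top_of_le_ne_top htop (tsum_green_le_expHit μ z)
  have hgreen : ∀ x, green μ z x ≠ ⊤ := fun x =>
    ENNReal.ne_top_of_tsum_ne_top (tsum_w_mul_voltage (G := G) z ▸ hE) x
  have hvolt : ∀ x, voltage G μ z x ≠ ⊤ := fun x =>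
    ENNReal.div_ne_top (hgreen x) (G.vw_ne_zero x)
  have hpos : ∀ x y, (G.w x y).toReal ≠ 0 → 0 < G.w x y := fun x y h =>
    pos_iff_ne_zero.2 fun h0 => h (by rw [h0, ENNReal.toReal_zero])
  have hdiv : ∀ x, x ∉ z → ∑' y, (G.w x y).toReal *
      ((voltage G μ z x).toReal - (voltage G μ z y).toReal) = if x = o then 1 else 0 := by
    intro x hx
    have hgr := hμ.green_eq ho hx
    have hfin : ∑' y, G.w x y * voltage G μ z y ≠ ⊤ :=
      ne_top_of_le_ne_top (hgreen x) (hgr ▸ le_add_self)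
    have hs1 : HasSum (fun y => (G.w x y).toReal * (voltage G μ z x).toReal)
        (green μ z x).toReal := by
      rw [← vw_mul_voltage (G := G), ENNReal.toReal_mul]
      exact (hasSum_toReal_tsum (G.vw_ne_top x)).mul_right _
    have hs2 := hasSum_toReal_tsum hfin
    simp only [ENNReal.toReal_mul] at hs2
    simp only [mul_sub]
    rw [(hs1.sub hs2).tsum_eq, hgr, ENNReal.toReal_add (by split_ifs <;> simp) hfin,
      add_sub_cancel_right]
    split_ifs <;> simp
  have hz : G.setWeight z ≠ ⊤ := fun h => by
    rw [h, ENNReal.mul_top two_ne_zero, ENNReal.top_div_of_ne_top (G.vw_ne_top o)] at hsol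
    exact ENNReal.ofReal_ne_top hsol
  have hwz : HasSum (fun p : V × V => if p.1 ∈ z then (G.w p.1 p.2).toReal else 0)
      (G.setWeight z).toReal := by
    have h : ∑' p : V × V, (if p.1 ∈ z then G.w p.1 p.2 else 0) = G.setWeight z := by
      rw [ENNReal.tsum_prod', WeightedGraph.setWeight, tsum_subtype z G.vw]
      refine tsum_congr fun x => ?_
      by_cases hx : x ∈ z <;> simp [hx, WeightedGraph.vw]
    have h' := hasSum_toReal_tsum (h ▸ hz)
    rw [h] at h'
    simpa only [apply_ite ENNReal.toReal, ENNReal.toReal_zero] using h'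
  have hsol' : (g - 1) ^ 2 * g ^ ((n : ℝ) - 2)
      = 2 * (G.setWeight z).toReal / (G.vw o).toReal := by
    have h := congrArg ENNReal.toReal hsol
    rwa [ENNReal.toReal_ofReal (by positivity), ENNReal.toReal_div, ENNReal.toReal_mul,
      ENNReal.toReal_ofNat] at h
  have hsum := ENNReal.summable_toReal hE
  simp only [ENNReal.toReal_mul] at hsum
  have hmain := tsum_potential_lower_bound (a := fun x y => (G.w x y).toReal)
    (v := fun x => (voltage G μ z x).toReal) (d := cappedDist G o n) (z := z)
    (W := (G.vw o).toReal) hn hg (fun _ _ => ENNReal.toReal_nonneg)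
    (fun x y => by rw [G.symm]) (fun _ => ENNReal.toReal_nonneg)
    (fun x => ENNReal.toReal_mono (hvolt o) (hμ.voltage_le ho x))
    (fun x hx => by rw [voltage_of_mem hx, ENNReal.toReal_zero]) ho hsum hdiv
    (hasSum_toReal_tsum (G.vw_ne_top o))
    (ENNReal.toReal_pos (G.vw_ne_zero o) (G.vw_ne_top o)) hwz
    (fun _ => cappedDist_le) cappedDist_self (fun x y h => cappedDist_le_succ (hpos x y h))
    (fun x y h hy => le_cappedDist_of_distGE hdist (hpos x y h) hy) hsol'
  have hreal : ∑' p : V × V, (G.w p.1 p.2).toReal * (voltage G μ z p.1).toReal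
      = (∑' x, green μ z x).toReal := by
    rw [← tsum_w_mul_voltage (G := G), ← (hasSum_toReal_tsum hE).tsum_eq]
    simp only [ENNReal.toReal_mul]
  rw [hreal] at hmain
  exact ((ENNReal.ofReal_le_ofReal hmain).trans ENNReal.ofReal_toReal_le).trans
    (tsum_green_le_expHit μ z)

end RWHitting
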